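/- Fourier multiplier formula for the Tilbert transform. Let 0 < h < ∞, let f : ℝ → ℂ be a Schwartz function, and let F : ℝ → ℂ be a bounded measurable function such that for every x ∈ ℝ, (1/(2h)) ∫_{|x-y|>ε} coth(π(x-y)/(2h)) f(y) dy → F(x) as ε → 0⁺ (i.e. F = 𝒯_h f as a principal value). Then for every Schwartz function φ whose Fourier transform φ̂ vanishes on a neighborhood of ξ = 0, one has ∫_ℝ F(x) · conj(φ(x)) dx = ∫_ℝ (−i coth(hξ)) · f̂(ξ) · conj(φ̂(ξ)) dξ. In other words, 𝒯_h is the Fourier multiplier operator with symbol −i coth(hξ). -/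

import Mathlib

open MeasureTheory Complex Filter

/-- The real hyperbolic cotangent. -/
noncomputable def coth (x : ℝ) : ℝ := Real.cosh x / Real.sinh x

/-- The Fourier transform, normalized as `ĝ(ξ) = (2π)^{-1/2} ∫ g(y) e^{-iyξ} dy`. -/
noncomputable def FT (f : ℝ → ℂ) (ξ : ℝ) : ℂ :=
  (Real.sqrt (2 * Real.pi))⁻¹ • ∫ x : ℝ, f x * Complex.exp (-(Complex.I * x * ξ))

/-- The ε-truncated Tilbert transform
`(1/(2h)) ∫_{|x-y|>ε} coth(π(x-y)/(2h)) f(y) dy`. -/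
noncomputable def truncTilbert (h : ℝ) (f : ℝ → ℂ) (x ε : ℝ) : ℂ :=
  (2 * h)⁻¹ • ∫ y in {y : ℝ | ε < |x - y|},
    (coth (Real.pi * (x - y) / (2 * h)) : ℂ) * f y


lemma coth_eq_one_add {t : ℝ} (ht : t ≠ 0) : coth t = 1 + 2 / (Real.exp (2 * t) - 1) := by
  have h1 : Real.exp (2 * t) - 1 ≠ 0 := by
    intro h
    have : Real.exp (2 * t) = 1 := by linarith
    rw [Real.exp_eq_one_iff] at this
    exact ht (by linarith)
  have h2 : Real.sinh t ≠ 0 := by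
    rwa [Ne, Real.sinh_eq_zero]
  have e2 : Real.exp (2 * t) = Real.exp t * Real.exp t := by rw [← Real.exp_add]; ring_nf
  have e3 : Real.exp (-t) * Real.exp t = 1 := by rw [← Real.exp_add]; simp
  unfold coth
  field_simp
  rw [Real.cosh_eq, Real.sinh_eq, e2]
  linear_combination Real.exp t * e3

lemma one_add_exp_lower {t : ℝ} : t * Real.exp (t/2) ≤ Real.exp t - 1 ∨ t < 0 := by
  by_cases ht : t < 0
  · right; exact ht
  left
  push Not at ht
  have h1 : t / 2 ≤ Real.sinh (t / 2) := Real.self_le_sinh_iff.2 (by linarith)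
  rw [Real.sinh_eq] at h1
  have e2 : Real.exp t = Real.exp (t/2) * Real.exp (t/2) := by rw [← Real.exp_add]; ring_nf
  have e3 : Real.exp (-(t/2)) * Real.exp (t/2) = 1 := by rw [← Real.exp_add]; simp
  nlinarith [Real.exp_pos (t/2)]

lemma coth_nonneg {t : ℝ} (ht : 0 < t) : 0 ≤ coth t := by
  unfold coth
  have := Real.sinh_pos_iff.2 ht
  have := Real.cosh_pos t
  positivity

lemma coth_le {t : ℝ} (ht : 0 < t) : coth t ≤ 1 + 1 / t := by
  rw [coth_eq_one_add ht.ne']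
  have h1 : 2 * t ≤ Real.exp (2 * t) - 1 := by linarith [Real.add_one_le_exp (2 * t)]
  have : 2 / (Real.exp (2 * t) - 1) ≤ 2 / (2 * t) := by gcongr
  have h3 : 2 / (2 * t) = 1 / t := by field_simp
  linarith

lemma coth_neg (t : ℝ) : coth (-t) = - coth t := by
  unfold coth
  rw [Real.cosh_neg, Real.sinh_neg, div_neg]

lemma measurable_coth : Measurable coth := by
  unfold coth
  exact Real.continuous_cosh.measurable.div Real.continuous_sinh.measurable

lemma integrableOn_div_exp : IntegrableOn (fun t : ℝ => t / (Real.exp t - 1)) (Set.Ioi 0) := by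
  have h1 : IntegrableOn (fun t : ℝ => Real.exp (-(1/2) * t)) (Set.Ioi 0) :=
    integrableOn_exp_mul_Ioi (by norm_num) 0
  refine h1.mono' (Measurable.aestronglyMeasurable (by fun_prop)) ?_
  filter_upwards [ae_restrict_mem measurableSet_Ioi] with t ht
  have ht : 0 < t := ht
  have h2 : t * Real.exp (t/2) ≤ Real.exp t - 1 := by
    rcases one_add_exp_lower (t := t) with h | h
    · exact h
    · linarith
  have h3 : 0 < t * Real.exp (t/2) := by positivity
  rw [Real.norm_of_nonneg (by apply div_nonneg ht.le; linarith), div_le_iff₀ (by linarith)]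
  calc t = Real.exp (-(1/2) * t) * (t * Real.exp (t/2)) := by
        rw [mul_left_comm, ← Real.exp_add]; ring_nf; simp
    _ ≤ _ := by gcongr

lemma integral_sin_exp (a : ℝ) {n : ℝ} (hn : 0 < n) :
    ∫ t in Set.Ioi (0:ℝ), Real.sin (a * t) * Real.exp (-n * t) = a / (n^2 + a^2) := by
  have hre : ((-n + a * I : ℂ)).re < 0 := by simp [hn]
  have h1 := integral_exp_mul_complex_Ioi hre 0
  have h2 := integrableOn_exp_mul_complex_Ioi hre 0
  have h3 : ∀ t : ℝ, Real.sin (a * t) * Real.exp (-n * t) = (cexp ((-n + a * I : ℂ) * t)).im := by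
    intro t
    rw [Complex.exp_im]
    simp [mul_comm]
  simp_rw [h3]
  have h4 := integral_im (𝕜 := ℂ) (f := fun t : ℝ => cexp ((-n + a * I : ℂ) * t)) h2
  simp only [RCLike.im_to_complex] at h4
  rw [h4, h1]
  simp [Complex.div_im, Complex.normSq_apply]
  ring

lemma sum_eq_coth {a : ℝ} (ha : a ≠ 0) :
    (∑' n : ℕ, a / (((n : ℝ) + 1)^2 + a^2)) = (Real.pi * coth (Real.pi * a) - 1 / a) / 2 := by
  have hz : (I * a : ℂ) ∈ Complex.integerComplement := by
    rw [Complex.mem_integerComplement_iff]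
    rintro ⟨n, hn⟩
    have := congrArg Complex.im hn
    simp at this
    exact ha this.symm
  have h := cot_series_rep' hz
  have hs : Complex.sinh (Real.pi * a) ≠ 0 := by
    rw [← Complex.ofReal_mul, ← Complex.ofReal_sinh]
    norm_cast
    rw [Real.sinh_eq_zero]
    exact mul_ne_zero Real.pi_ne_zero ha
  have haC : (a : ℂ) ≠ 0 := by exact_mod_cast ha
  have e1 : Complex.cot (Real.pi * (I * a)) = -I * (coth (Real.pi * a) : ℝ) := by
    have : (Real.pi * (I * a) : ℂ) = (Real.pi * a) * I := by ring
    unfold coth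
    rw [this, Complex.cot, Complex.cos_mul_I, Complex.sin_mul_I]
    push_cast
    field_simp
    simp
  have e2 : ∀ n : ℕ, (1 / ((I * a : ℂ) - (n + 1)) + 1 / (I * a + (n + 1))) =
      (-2 * I) * ((a / (((n : ℝ) + 1)^2 + a^2) : ℝ) : ℂ) := by
    intro n
    have hn : (0:ℝ) < (n:ℝ) + 1 := by positivity
    have n1 : (I * a : ℂ) - (n + 1) ≠ 0 := by
      intro h
      have := congrArg Complex.im h
      simp at this
      exact ha this
    have n2 : (I * a : ℂ) + (n + 1) ≠ 0 := by
      intro h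
      have := congrArg Complex.im h
      simp at this
      exact ha this
    have n3 : (((n : ℂ) + 1)^2 + a^2) ≠ 0 := by
      have : (((n : ℝ) + 1)^2 + a^2) ≠ 0 := by positivity
      exact_mod_cast this
    push_cast
    field_simp
    ring_nf
    simp [show I^3 = -I by rw [pow_succ, I_sq]; ring]
  simp_rw [e2] at h
  rw [tsum_mul_left, e1, ← Complex.ofReal_tsum] at h
  have h5 : (((∑' n : ℕ, a / (((n : ℝ) + 1)^2 + a^2) : ℝ)) : ℂ) =
      (((Real.pi * coth (Real.pi * a) - 1 / a) / 2 : ℝ) : ℂ) := by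
    have h6 := congrArg (fun z => z * (I / 2)) h
    push_cast
    have : (-2 * I * ((∑' n : ℕ, a / (((n : ℝ) + 1)^2 + a^2) : ℝ) : ℂ)) * (I / 2) =
      ((∑' n : ℕ, a / (((n : ℝ) + 1)^2 + a^2) : ℝ) : ℂ) := by
      linear_combination (-((∑' n : ℕ, a / (((n : ℝ) + 1)^2 + a^2) : ℝ) : ℂ)) * I_sq
    rw [this] at h6
    push_cast at h6
    rw [← h6]
    field_simp
    linear_combination (- Real.pi * a * (coth (Real.pi * a) : ℂ)) * I_sq
  exact_mod_cast h5

lemma integral_sin_div_exp {a : ℝ} (ha : a ≠ 0) :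
    ∫ t in Set.Ioi (0:ℝ), Real.sin (a * t) / (Real.exp t - 1) =
      (Real.pi * coth (Real.pi * a) - 1 / a) / 2 := by
  rw [← sum_eq_coth ha]
  have hx : ∀ n : ℕ, ∫ t in Set.Ioi (0:ℝ), t * Real.exp (-((n:ℝ) + 1) * t)
      = 1 / ((n:ℝ)+1)^2 := by
    intro n
    have := Real.integral_rpow_mul_exp_neg_mul_Ioi (a := 2) (r := (n:ℝ)+1) (by norm_num) (by positivity)
    norm_num at this
    rw [← one_div] at this
    simp only [neg_mul]; exact this
  have hxi : ∀ n : ℕ, IntegrableOn (fun t : ℝ => t * Real.exp (-((n:ℝ) + 1) * t)) (Set.Ioi 0) := by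
    intro n
    by_contra hcon
    have := hx n
    rw [integral_undef hcon] at this
    have h3 : (0:ℝ) < 1 / ((n:ℝ)+1)^2 := by positivity
    linarith
  have hb : ∀ n : ℕ, ∀ t ∈ Set.Ioi (0:ℝ), ‖Real.sin (a * t) * Real.exp (-((n:ℝ) + 1) * t)‖ ≤
      |a| * (t * Real.exp (-((n:ℝ) + 1) * t)) := by
    intro n t ht
    have ht : 0 < t := ht
    rw [norm_mul, Real.norm_eq_abs, Real.norm_of_nonneg (Real.exp_pos _).le, ← mul_assoc]
    gcongr
    calc _ ≤ |a * t| := Real.abs_sin_le_abs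
      _ = _ := by rw [abs_mul, abs_of_pos ht]
  have hi : ∀ n : ℕ, IntegrableOn (fun t : ℝ => Real.sin (a * t) * Real.exp (-((n:ℝ) + 1) * t))
      (Set.Ioi 0) := by
    intro n
    refine Integrable.mono' ((hxi n).const_mul |a|) (by fun_prop) ?_
    filter_upwards [ae_restrict_mem measurableSet_Ioi] with t ht using hb n t ht
  have hsum : Summable fun n : ℕ =>
      ∫ t in Set.Ioi (0:ℝ), ‖Real.sin (a * t) * Real.exp (-((n:ℝ) + 1) * t)‖ := by
    have hs : Summable fun n : ℕ => |a| * (1 / ((n:ℝ) + 1)^2) := by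
      apply Summable.mul_left
      have := (summable_nat_add_iff 1).2 (Real.summable_one_div_nat_pow.2 (by norm_num : 1 < 2))
      simpa using this
    refine Summable.of_nonneg_of_le (fun n => integral_nonneg fun t => norm_nonneg _) ?_ hs
    intro n
    rw [← hx n, ← integral_const_mul]
    exact setIntegral_mono_on (hi n).norm ((hxi n).const_mul _) measurableSet_Ioi (hb n)
  have key := hasSum_integral_of_summable_integral_norm hi hsum
  rw [← key.tsum_eq.symm.trans (tsum_congr fun n => integral_sin_exp a (by positivity : (0:ℝ) < (n:ℝ)+1))]
  refine setIntegral_congr_fun measurableSet_Ioi ?_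
  intro t ht
  have ht : 0 < t := ht
  simp only
  rw [tsum_mul_left, div_eq_mul_inv]
  congr 1
  have hlt : Real.exp (-t) < 1 := by simpa using ht
  have g := tsum_geometric_of_lt_one (Real.exp_pos (-t)).le hlt
  have : ∀ n : ℕ, Real.exp (-((n:ℝ) + 1) * t) = Real.exp (-t) * Real.exp (-t) ^ n := by
    intro n
    rw [← Real.exp_nat_mul, ← Real.exp_add]; ring_nf
  simp_rw [this]
  rw [tsum_mul_left, g, Real.exp_neg]
  have h1 : 1 < Real.exp t := by simpa using ht
  have h2 : Real.exp t - 1 ≠ 0 := by linarith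
  have h3 : 1 - (Real.exp t)⁻¹ ≠ 0 := by
    rw [← Real.exp_neg]; linarith
  field_simp

lemma integral_two_sin_exp {h : ℝ} (hh : 0 < h) {ξ : ℝ} (hξ : ξ ≠ 0) :
    ∫ t in Set.Ioi (0:ℝ), 2 / (Real.exp (Real.pi * t / h) - 1) * Real.sin (t * ξ) =
      h * coth (h * ξ) - 1 / ξ := by
  have hpi := Real.pi_pos
  have ha : h * ξ / Real.pi ≠ 0 := by positivity
  have h1 := integral_comp_mul_left_Ioi
    (fun u => Real.sin (h * ξ / Real.pi * u) / (Real.exp u - 1)) 0 (b := Real.pi / h) (by positivity)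
  rw [mul_zero, integral_sin_div_exp ha] at h1
  have h2 : ∀ t : ℝ, 2 / (Real.exp (Real.pi * t / h) - 1) * Real.sin (t * ξ) =
      2 * (Real.sin (h * ξ / Real.pi * (Real.pi / h * t)) / (Real.exp (Real.pi / h * t) - 1)) := by
    intro t
    have e1 : h * ξ / Real.pi * (Real.pi / h * t) = t * ξ := by field_simp
    have e2 : Real.pi / h * t = Real.pi * t / h := by ring
    rw [e1, e2]; ring
  simp_rw [h2]
  rw [integral_const_mul, h1]
  have e3 : Real.pi * (h * ξ / Real.pi) = h * ξ := by field_simp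
  rw [e3, smul_eq_mul]
  field_simp

lemma tendsto_cos_zero (G : ℝ → ℂ) (hG : Integrable G) :
    Tendsto (fun t : ℝ => ∫ ξ, (Real.cos (t * ξ) : ℂ) * G ξ) atTop (nhds 0) := by
  have hRL := Real.tendsto_integral_exp_smul_cocompact G
  have hpi := Real.pi_pos
  have t1 : Tendsto (fun t : ℝ => t / (2 * Real.pi)) atTop (cocompact ℝ) :=
    (tendsto_id.atTop_div_const (by positivity)).mono_right atTop_le_cocompact
  have t2 : Tendsto (fun t : ℝ => -(t / (2 * Real.pi))) atTop (cocompact ℝ) :=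
    (tendsto_neg_atTop_atBot.comp (tendsto_id.atTop_div_const (by positivity))).mono_right
      atBot_le_cocompact
  have h := ((hRL.comp t1).add (hRL.comp t2)).div_const 2
  simp only [add_zero, zero_div] at h
  refine h.congr ?_
  intro t
  have hm : ∀ w : ℝ, Integrable fun v : ℝ => Real.fourierChar (-(v * w)) • G v := by
    intro w
    have := (Real.fourierIntegral_convergent_iff (μ := volume) (f := G) w).2 hG
    simpa [mul_comm] using this
  simp only [Function.comp_apply]
  rw [← integral_add (hm _) (hm _), ← integral_div]
  refine integral_congr_ae (Eventually.of_forall fun ξ => ?_)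
  simp only [Circle.smul_def, Real.fourierChar_apply, smul_eq_mul]
  have e1 : ((2 * Real.pi * -(ξ * (t / (2 * Real.pi))) : ℝ) : ℂ) * I = -(t * ξ : ℂ) * I := by
    congr 1
    rw [show 2 * Real.pi * -(ξ * (t / (2 * Real.pi))) = -(t * ξ) by field_simp]
    push_cast; rfl
  have e2 : ((2 * Real.pi * -(ξ * -(t / (2 * Real.pi))) : ℝ) : ℂ) * I = (t * ξ : ℂ) * I := by
    congr 1
    rw [show 2 * Real.pi * -(ξ * -(t / (2 * Real.pi))) = (t * ξ) by field_simp]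
    push_cast; rfl
  rw [e1, e2]
  push_cast
  rw [Complex.cos]
  ring

lemma hasDerivAt_cos_int (g G : ℝ → ℂ) (hg : Integrable g) (hG : Integrable G)
    (hgG : ∀ ξ : ℝ, g ξ = ξ * G ξ) (t : ℝ) :
    HasDerivAt (fun t : ℝ => ∫ ξ, (Real.cos (t * ξ) : ℂ) * G ξ)
      (-∫ ξ, (Real.sin (t * ξ) : ℂ) * g ξ) t := by
  rw [← integral_neg]
  refine (hasDerivAt_integral_of_dominated_loc_of_deriv_le (μ := volume) (s := Set.univ)
    (F := fun (t : ℝ) (ξ : ℝ) => (Real.cos (t * ξ) : ℂ) * G ξ)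
    (F' := fun (t : ℝ) (ξ : ℝ) => -((Real.sin (t * ξ) : ℂ) * g ξ)) (bound := fun ξ => ‖g ξ‖)
    univ_mem ?_ ?_ ?_ ?_ ?_ ?_).2
  · refine Eventually.of_forall fun t => ?_
    exact (Continuous.aestronglyMeasurable (by fun_prop)).mul hG.aestronglyMeasurable
  · refine hG.mono ((Continuous.aestronglyMeasurable (by fun_prop)).mul hG.aestronglyMeasurable) ?_
    refine Eventually.of_forall fun ξ => ?_
    rw [norm_mul, Complex.norm_real]
    exact mul_le_of_le_one_left (norm_nonneg _) (Real.abs_cos_le_one _)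
  · exact ((Continuous.aestronglyMeasurable (by fun_prop)).mul hg.aestronglyMeasurable).neg
  · refine Eventually.of_forall fun ξ t _ => ?_
    rw [norm_neg, norm_mul, Complex.norm_real]
    exact mul_le_of_le_one_left (norm_nonneg _) (Real.abs_sin_le_one _)
  · exact hg.norm
  · refine Eventually.of_forall fun ξ t _ => ?_
    have h1 : HasDerivAt (fun t : ℝ => Real.cos (t * ξ)) (-Real.sin (t * ξ) * ξ) t := by
      have := (hasDerivAt_mul_const (x := t) ξ).cos
      simpa using this
    have h2 := (h1.ofReal_comp).mul_const (G ξ)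
    refine HasDerivAt.congr_deriv h2 ?_
    rw [hgG]; push_cast; ring

lemma multiplier_aux {h : ℝ} (hh : 0 < h) (g : ℝ → ℂ) (hg : Integrable g)
    (hxg : Integrable (fun ξ : ℝ => (ξ : ℂ) * g ξ)) {δ : ℝ} (hδ0 : 0 < δ)
    (hδ : ∀ ξ, |ξ| < δ → g ξ = 0)
    (hcint : IntegrableOn (fun t : ℝ => (coth (Real.pi * t / (2 * h)) : ℂ) *
      ∫ ξ : ℝ, (Real.sin (t * ξ) : ℂ) * g ξ) (Set.Ioi 0)) :
    ∫ t in Set.Ioi (0:ℝ), (coth (Real.pi * t / (2 * h)) : ℂ) *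
      (∫ ξ : ℝ, (Real.sin (t * ξ) : ℂ) * g ξ) = h * ∫ ξ : ℝ, (coth (h * ξ) : ℂ) * g ξ := by
  have hpi := Real.pi_pos
  set S : ℝ → ℂ := fun t => ∫ ξ : ℝ, (Real.sin (t * ξ) : ℂ) * g ξ with hS
  set E : ℝ → ℝ := fun t => 2 / (Real.exp (Real.pi * t / h) - 1) with hE
  have hEm : Measurable E := by fun_prop
  set G : ℝ → ℂ := fun ξ => g ξ / ξ with hGdef
  have hg0 : g 0 = 0 := hδ 0 (by simpa using hδ0)
  have hgG : ∀ ξ : ℝ, g ξ = ξ * G ξ := by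
    intro ξ
    by_cases hξ : ξ = 0
    · simp [hξ, hg0]
    · have : (ξ : ℂ) ≠ 0 := by exact_mod_cast hξ
      simp only [hGdef]; field_simp
  have hG : Integrable G := by
    refine (hg.norm.const_mul δ⁻¹).mono' ?_ ?_
    · exact hg.aestronglyMeasurable.div₀ (Measurable.aestronglyMeasurable (by fun_prop))
    · refine Eventually.of_forall fun ξ => ?_
      by_cases hξ : |ξ| < δ
      · simp [hGdef, hδ ξ hξ]
      · push Not at hξ
        simp only [hGdef]
        rw [norm_div, Complex.norm_real, Real.norm_eq_abs, div_eq_inv_mul]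
        gcongr
  have hcoth : ∀ t ∈ Set.Ioi (0:ℝ), (coth (Real.pi * t / (2 * h)) : ℂ) * S t =
      S t + (E t : ℂ) * S t := by
    intro t ht
    have ht : 0 < t := ht
    rw [coth_eq_one_add (by positivity)]
    have : 2 * (Real.pi * t / (2 * h)) = Real.pi * t / h := by field_simp
    rw [this]
    simp only [hE]
    push_cast
    ring
  have hEt : IntegrableOn (fun t : ℝ => t * E t) (Set.Ioi 0) := by
    have h1 := (integrableOn_Ioi_comp_mul_left_iff (fun t : ℝ => t / (Real.exp t - 1)) 0
      (a := Real.pi / h) (by positivity)).2 (by simpa using integrableOn_div_exp)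
    have h2 := h1.const_mul (2 * h / Real.pi)
    refine h2.congr (Eventually.of_forall fun t => ?_)
    simp only [hE]
    rw [show Real.pi / h * t = Real.pi * t / h by ring]
    field_simp
  have hprod : Integrable (fun p : ℝ × ℝ => (E p.1 : ℂ) * ((Real.sin (p.1 * p.2) : ℂ) * g p.2))
      ((volume.restrict (Set.Ioi 0)).prod volume) := by
    have hb : Integrable (fun p : ℝ × ℝ => ((p.1 * E p.1 : ℝ) : ℂ) * ((p.2 : ℂ) * g p.2))
      ((volume.restrict (Set.Ioi 0)).prod volume) := Integrable.mul_prod (hEt.ofReal) hxg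
    refine hb.mono ?_ ?_
    · have hgm : AEStronglyMeasurable (fun p : ℝ × ℝ => g p.2)
        ((volume.restrict (Set.Ioi 0)).prod volume) := hg.aestronglyMeasurable.comp_snd
      have m1 : Measurable (fun p : ℝ × ℝ => (E p.1 : ℂ)) := by fun_prop
      have m2 : Measurable (fun p : ℝ × ℝ => (Real.sin (p.1 * p.2) : ℂ)) := by fun_prop
      exact m1.aestronglyMeasurable.mul (m2.aestronglyMeasurable.mul hgm)
    · refine Eventually.of_forall fun p => ?_
      simp only [norm_mul, Complex.norm_real]
      have : ‖Real.sin (p.1 * p.2)‖ ≤ ‖p.1‖ * ‖p.2‖ := by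
        rw [← norm_mul]; exact Real.abs_sin_le_abs
      calc _ ≤ ‖E p.1‖ * (‖p.1‖ * ‖p.2‖ * ‖g p.2‖) := by gcongr
        _ = _ := by ring
  have hES : ∀ t : ℝ, (E t : ℂ) * S t = ∫ ξ : ℝ, (E t : ℂ) * ((Real.sin (t * ξ) : ℂ) * g ξ) := by
    intro t
    rw [integral_const_mul]
  have hESint : IntegrableOn (fun t => (E t : ℂ) * S t) (Set.Ioi 0) := by
    simp_rw [hES]
    exact hprod.integral_prod_left
  have hSint : IntegrableOn S (Set.Ioi 0) := by
    refine (hcint.sub hESint).congr ?_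
    filter_upwards [ae_restrict_mem measurableSet_Ioi] with t ht
    simp only [Pi.sub_apply]
    rw [hcoth t ht]; ring
  rw [setIntegral_congr_fun measurableSet_Ioi hcoth, integral_add hSint hESint]
  have i1 : ∫ t in Set.Ioi (0:ℝ), S t = ∫ ξ, G ξ := by
    have := integral_Ioi_of_hasDerivAt_of_tendsto' (a := 0)
      (fun t _ => hasDerivAt_cos_int g G hg hG hgG t) hSint.neg (tendsto_cos_zero G hG)
    rw [integral_neg] at this
    simpa [hS] using this
  have i2' : ∀ ξ : ℝ, ∫ t in Set.Ioi (0:ℝ), (E t : ℂ) * ((Real.sin (t * ξ) : ℂ) * g ξ) =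
      h * ((coth (h * ξ) : ℂ) * g ξ) - G ξ := by
    intro ξ
    by_cases hξ : ξ = 0
    · simp [hξ, hGdef, hg0]
    have h3 : ∫ t in Set.Ioi (0:ℝ), (E t : ℂ) * (Real.sin (t * ξ) : ℂ) =
        ((h * coth (h * ξ) - 1 / ξ : ℝ) : ℂ) := by
      rw [← integral_two_sin_exp hh hξ, ← integral_complex_ofReal]
      simp [hE]
    simp_rw [← mul_assoc]
    rw [integral_mul_const, h3]
    simp only [hGdef]
    push_cast
    ring
  have hcint2 : Integrable (fun ξ : ℝ => h * ((coth (h * ξ) : ℂ) * g ξ) - G ξ) := by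
    have := hprod.integral_prod_right
    simp_rw [i2'] at this
    exact this
  have i2 : ∫ t in Set.Ioi (0:ℝ), (E t : ℂ) * S t =
      ∫ ξ : ℝ, (h * ((coth (h * ξ) : ℂ) * g ξ) - G ξ) := by
    simp_rw [hES]
    rw [integral_integral_swap hprod]
    simp_rw [i2']
  rw [i1, i2, ← integral_add hG hcint2, ← integral_const_mul]
  congr 1
  ext ξ
  ring

open scoped FourierTransform in
lemma FT_eq (f : SchwartzMap ℝ ℂ) (ξ : ℝ) :
    FT f ξ = ((Real.sqrt (2 * Real.pi))⁻¹ : ℝ) * (𝓕 f : SchwartzMap ℝ ℂ) (ξ / (2 * Real.pi)) := by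
  have hpi := Real.pi_pos
  unfold FT
  rw [Complex.real_smul, SchwartzMap.fourier_coe, Real.fourier_real_eq_integral_exp_smul]
  congr 1
  refine integral_congr_ae (Eventually.of_forall fun x => ?_)
  simp only [smul_eq_mul]
  rw [mul_comm]
  congr 2
  rw [show -2 * Real.pi * x * (ξ / (2 * Real.pi)) = -(x * ξ) by field_simp]
  push_cast; ring

open scoped FourierTransform in
lemma parseval (f φ : SchwartzMap ℝ ℂ) :
    ∫ x : ℝ, f x * (starRingEnd ℂ) (φ x) = ∫ ξ : ℝ, FT f ξ * (starRingEnd ℂ) (FT φ ξ) := by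
  have hpi := Real.pi_pos
  have h := SchwartzMap.integral_inner_fourier_fourier φ f
  simp only [RCLike.inner_apply] at h
  rw [← h]
  simp_rw [FT_eq]
  have h2 := Measure.integral_comp_div (fun ξ : ℝ => (𝓕 f : SchwartzMap ℝ ℂ) ξ *
    (starRingEnd ℂ) ((𝓕 φ : SchwartzMap ℝ ℂ) ξ)) (2 * Real.pi)
  have h3 : ∀ ξ : ℝ, ((Real.sqrt (2 * Real.pi))⁻¹ : ℝ) * (𝓕 f : SchwartzMap ℝ ℂ) (ξ / (2 * Real.pi)) *
      (starRingEnd ℂ) (((Real.sqrt (2 * Real.pi))⁻¹ : ℝ) *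
        (𝓕 φ : SchwartzMap ℝ ℂ) (ξ / (2 * Real.pi))) =
      (((2 * Real.pi)⁻¹ : ℝ) : ℂ) * ((𝓕 f : SchwartzMap ℝ ℂ) (ξ / (2 * Real.pi)) *
      (starRingEnd ℂ) ((𝓕 φ : SchwartzMap ℝ ℂ) (ξ / (2 * Real.pi)))) := by
    intro ξ
    have : (((2 * Real.pi)⁻¹ : ℝ) : ℂ) = ((Real.sqrt (2 * Real.pi))⁻¹ : ℝ) *
        ((Real.sqrt (2 * Real.pi))⁻¹ : ℝ) := by
      rw [← Complex.ofReal_mul, ← mul_inv, Real.mul_self_sqrt (by positivity)]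
    rw [this, map_mul, Complex.conj_ofReal]
    ring
  simp_rw [h3]
  rw [integral_const_mul, h2, abs_of_pos (by positivity), Complex.real_smul, ← mul_assoc,
    ← Complex.ofReal_mul, inv_mul_cancel₀ (by positivity), Complex.ofReal_one, one_mul]

lemma FT_shift (f : SchwartzMap ℝ ℂ) (t ξ : ℝ) :
    FT (f.compSubConstCLM ℝ t) ξ = cexp (-(I * t * ξ)) * FT f ξ := by
  unfold FT
  simp only [SchwartzMap.compSubConstCLM_apply]
  have h := integral_sub_right_eq_self (μ := volume)
    (fun x : ℝ => f x * cexp (-(I * (x + t) * ξ))) t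
  have e1 : ∀ x : ℝ, f (x - t) * cexp (-(I * ((x - t : ℝ) + t) * ξ)) =
      f (x - t) * cexp (-(I * x * ξ)) := by
    intro x; push_cast; ring_nf
  simp_rw [e1] at h
  rw [h, Complex.real_smul, Complex.real_smul, mul_left_comm, ← integral_const_mul (cexp _)]
  congr 2
  ext x
  rw [mul_left_comm, ← Complex.exp_add]
  ring_nf

lemma FT_bdd (f : SchwartzMap ℝ ℂ) : ∃ C, ∀ ξ, ‖FT f ξ‖ ≤ C := by
  refine ⟨(Real.sqrt (2 * Real.pi))⁻¹ * ∫ x, ‖f x‖, fun ξ => ?_⟩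
  unfold FT
  rw [norm_smul, Real.norm_of_nonneg (by positivity)]
  gcongr
  refine (norm_integral_le_integral_norm _).trans (le_of_eq ?_)
  congr 1
  ext x
  rw [norm_mul, show -(I * x * ξ) = ((-(x * ξ) : ℝ) : ℂ) * I by push_cast; ring,
    Complex.norm_exp_ofReal_mul_I, mul_one]

open scoped FourierTransform in
lemma FT_cont (f : SchwartzMap ℝ ℂ) : Continuous (FT f) := by
  rw [show FT f = _ from funext (FT_eq f)]
  have := (𝓕 f : SchwartzMap ℝ ℂ).continuous
  fun_prop

open scoped FourierTransform in
lemma FT_integrable (f : SchwartzMap ℝ ℂ) : Integrable (FT f) := by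
  rw [show FT f = _ from funext (FT_eq f)]
  exact (Integrable.comp_div (𝓕 f : SchwartzMap ℝ ℂ).integrable (by positivity)).const_mul _

open scoped FourierTransform in
lemma FT_integrable' (f : SchwartzMap ℝ ℂ) : Integrable (fun ξ : ℝ => (ξ : ℂ) * FT f ξ) := by
  have hpi := Real.pi_pos
  have h := (𝓕 f : SchwartzMap ℝ ℂ).integrable_pow_mul volume 1
  have h1 : Integrable (fun ξ : ℝ => (ξ : ℂ) * (𝓕 f : SchwartzMap ℝ ℂ) ξ) := by
    refine h.mono' (Continuous.aestronglyMeasurable ?_) ?_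
    · have := (𝓕 f : SchwartzMap ℝ ℂ).continuous
      fun_prop
    · exact Eventually.of_forall fun ξ => by simp
  have h2 := (Integrable.comp_div h1 (R := 2 * Real.pi) (by positivity)).const_mul
    (((2 * Real.pi * (Real.sqrt (2 * Real.pi))⁻¹ : ℝ)) : ℂ)
  refine h2.congr (Eventually.of_forall fun ξ => ?_)
  have : (Real.pi : ℂ) ≠ 0 := by exact_mod_cast hpi.ne'
  simp only
  rw [FT_eq]
  push_cast
  field_simp

lemma g_integrable (f φ : SchwartzMap ℝ ℂ) :
    Integrable (fun ξ => FT f ξ * (starRingEnd ℂ) (FT φ ξ)) := by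
  obtain ⟨C, hC⟩ := FT_bdd φ
  refine (FT_integrable f).mul_bdd (c := C)
    (Continuous.aestronglyMeasurable (Complex.continuous_conj.comp (FT_cont φ))) ?_
  exact Eventually.of_forall fun ξ => by simpa using hC ξ

lemma g_integrable' (f φ : SchwartzMap ℝ ℂ) :
    Integrable (fun ξ : ℝ => (ξ : ℂ) * (FT f ξ * (starRingEnd ℂ) (FT φ ξ))) := by
  obtain ⟨C, hC⟩ := FT_bdd φ
  simp_rw [← mul_assoc]
  refine (FT_integrable' f).mul_bdd (c := C)
    (Continuous.aestronglyMeasurable (Complex.continuous_conj.comp (FT_cont φ))) ?_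
  exact Eventually.of_forall fun ξ => by simpa using hC ξ

lemma shift_int (f φ : SchwartzMap ℝ ℂ) (t : ℝ) :
    Integrable (fun x : ℝ => f (x - t) * (starRingEnd ℂ) (φ x)) := by
  have h1 : Integrable (fun x : ℝ => f (x - t)) := f.integrable.comp_sub_right t
  refine h1.mul_bdd (c := SchwartzMap.seminorm ℝ 0 0 φ)
    (Continuous.aestronglyMeasurable (Complex.continuous_conj.comp φ.continuous)) ?_
  exact Eventually.of_forall fun ξ => by simpa using φ.norm_le_seminorm ℝ ξ

lemma parseval_diff (f φ : SchwartzMap ℝ ℂ) (t : ℝ) :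
    ∫ x : ℝ, (f (x - t) - f (x + t)) * (starRingEnd ℂ) (φ x) =
      (-2 * I) * ∫ ξ : ℝ, (Real.sin (t * ξ) : ℂ) * (FT f ξ * (starRingEnd ℂ) (FT φ ξ)) := by
  have hs : ∀ t : ℝ, ∫ x : ℝ, f (x - t) * (starRingEnd ℂ) (φ x) =
      ∫ ξ : ℝ, cexp (-(I * t * ξ)) * (FT f ξ * (starRingEnd ℂ) (FT φ ξ)) := by
    intro t
    have := parseval (f.compSubConstCLM ℝ t) φ
    simp only [SchwartzMap.compSubConstCLM_apply, FT_shift] at this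
    rw [this]
    simp_rw [mul_assoc]
  have hi : ∀ t : ℝ, Integrable
      (fun ξ : ℝ => cexp (-(I * t * ξ)) * (FT f ξ * (starRingEnd ℂ) (FT φ ξ))) := by
    intro t
    refine (g_integrable f φ).bdd_mul (c := 1) (Continuous.aestronglyMeasurable (by fun_prop)) ?_
    refine Eventually.of_forall fun ξ => ?_
    rw [show -(I * t * ξ) = ((-(t * ξ) : ℝ) : ℂ) * I by push_cast; ring,
      Complex.norm_exp_ofReal_mul_I]
  have h1 : ∀ x : ℝ, (f (x - t) - f (x + t)) * (starRingEnd ℂ) (φ x) =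
      f (x - t) * (starRingEnd ℂ) (φ x) - f (x - (-t)) * (starRingEnd ℂ) (φ x) := by
    intro x; rw [sub_neg_eq_add]; ring
  simp_rw [h1]
  rw [integral_sub (shift_int f φ t) (shift_int f φ (-t)), hs, hs, ← integral_sub (hi _) (hi _),
    ← integral_const_mul]
  congr 1
  ext ξ
  push_cast
  rw [Complex.sin, show -(I * t * ξ) = -(t * ξ : ℂ) * I by ring,
    show -(I * -t * ξ) = (t * ξ : ℂ) * I by ring]
  linear_combination (cexp (-(t * ξ : ℂ) * I) - cexp ((t * ξ : ℂ) * I)) *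
    (FT f ξ * (starRingEnd ℂ) (FT φ ξ)) * I_sq

lemma diff_bound (f : SchwartzMap ℝ ℂ) : ∃ M : ℝ, 0 ≤ M ∧ ∀ x t : ℝ, 0 < t →
    ‖f (x - t) - f (x + t)‖ ≤ M * t := by
  set M := SchwartzMap.seminorm ℝ 0 0 (SchwartzMap.derivCLM ℝ ℂ f) with hM
  have hb : ∀ x, ‖deriv f x‖ ≤ M := fun x =>
    SchwartzMap.norm_le_seminorm ℝ (SchwartzMap.derivCLM ℝ ℂ f) x
  have hM0 : 0 ≤ M := (norm_nonneg _).trans (hb 0)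
  refine ⟨2 * M, by positivity, fun x t ht => ?_⟩
  have := Convex.norm_image_sub_le_of_norm_deriv_le (f := f) (s := Set.univ) (C := M)
    (x := x + t) (y := x - t) (fun x _ => f.differentiableAt) (fun x _ => hb x) convex_univ
    (Set.mem_univ _) (Set.mem_univ _)
  refine this.trans (le_of_eq ?_)
  rw [Real.norm_eq_abs, show x - t - (x + t) = -(2 * t) by ring, abs_neg, abs_of_pos (by positivity)]
  ring

/-- The symmetrised integrand. -/
noncomputable def symInt (h : ℝ) (f : SchwartzMap ℝ ℂ) (x t : ℝ) : ℂ :=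
  (coth (Real.pi * t / (2 * h)) : ℂ) * (f (x - t) - f (x + t))

lemma symInt_bound {h : ℝ} (hh : 0 < h) (f : SchwartzMap ℝ ℂ) : ∃ A B : ℝ, 0 ≤ A ∧ 0 ≤ B ∧
    ∀ x t : ℝ, 0 < t → ‖symInt h f x t‖ ≤
      A * (‖f (x - t)‖ + ‖f (x + t)‖) + (Set.Ioc (0:ℝ) 1).indicator (fun _ => B) t := by
  obtain ⟨M, hM0, hM⟩ := diff_bound f
  have hpi := Real.pi_pos
  set c : ℝ := 2 * h / Real.pi with hc
  have hc0 : 0 < c := by positivity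
  refine ⟨1 + c, c * M, by positivity, by positivity, fun x t ht => ?_⟩
  have hct : coth (Real.pi * t / (2 * h)) ≤ 1 + c / t := by
    have h1 := coth_le (t := Real.pi * t / (2 * h)) (by positivity)
    have h2 : 1 / (Real.pi * t / (2 * h)) = c / t := by rw [hc]; field_simp
    rwa [h2] at h1
  have hn : ‖f (x - t) - f (x + t)‖ ≤ ‖f (x - t)‖ + ‖f (x + t)‖ := norm_sub_le _ _
  have h0 := coth_nonneg (t := Real.pi * t / (2 * h)) (by positivity)
  unfold symInt
  rw [norm_mul, Complex.norm_real, Real.norm_of_nonneg h0]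
  have h3 : coth (Real.pi * t / (2 * h)) * ‖f (x - t) - f (x + t)‖ ≤
      (1 + c / t) * ‖f (x - t) - f (x + t)‖ := by gcongr
  refine h3.trans ?_
  by_cases h1 : t ≤ 1
  · rw [Set.indicator_of_mem (show t ∈ Set.Ioc (0:ℝ) 1 from ⟨ht, h1⟩)]
    have h4 : c / t * ‖f (x - t) - f (x + t)‖ ≤ c / t * (M * t) := by gcongr; exact hM x t ht
    have h5 : c / t * (M * t) = c * M := by field_simp
    have h6 : 0 ≤ c * (‖f (x - t)‖ + ‖f (x + t)‖) := by positivity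
    nlinarith
  · rw [Set.indicator_of_notMem (fun hm => h1 hm.2), add_zero]
    have : c / t ≤ c := div_le_self hc0.le (by linarith)
    gcongr

lemma symInt_measurable (h : ℝ) (f : SchwartzMap ℝ ℂ) :
    Measurable (fun p : ℝ × ℝ => symInt h f p.2 p.1) := by
  unfold symInt
  have := measurable_coth
  have := f.continuous.measurable
  fun_prop

lemma symInt_integrable {h : ℝ} (hh : 0 < h) (f : SchwartzMap ℝ ℂ) (x : ℝ) :
    IntegrableOn (symInt h f x) (Set.Ioi 0) := by
  obtain ⟨A, B, hA, hB, hb⟩ := symInt_bound hh f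
  have i1 : Integrable (fun t : ℝ => f (x - t)) := f.integrable.comp_sub_left x
  have i2 : Integrable (fun t : ℝ => f (x + t)) := f.integrable.comp_add_left x
  have i3 : Integrable ((Set.Ioc (0:ℝ) 1).indicator (fun _ => B)) :=
    (integrable_indicator_iff measurableSet_Ioc).2 (integrableOn_const (by simp))
  have i4 := ((i1.norm.add i2.norm).const_mul A).add i3
  refine i4.integrableOn.mono' ?_ ?_
  · exact ((symInt_measurable h f).comp (measurable_id.prodMk measurable_const)).aestronglyMeasurable
  · filter_upwards [ae_restrict_mem measurableSet_Ioi] with t ht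
    exact hb x t ht

lemma conv_int (f φ : SchwartzMap ℝ ℂ) :
    Integrable (fun p : ℝ × ℝ => ‖f (p.2 - p.1)‖ * ‖φ p.2‖) (volume.prod volume) := by
  have := Integrable.convolution_integrand (ContinuousLinearMap.mul ℝ ℝ) (μ := volume) (ν := volume)
    φ.integrable.norm (f.integrable.comp_neg.norm)
  refine this.congr (Eventually.of_forall fun p => ?_)
  simp [mul_comm]

lemma conv_int' (f φ : SchwartzMap ℝ ℂ) :
    Integrable (fun p : ℝ × ℝ => ‖f (p.2 + p.1)‖ * ‖φ p.2‖) (volume.prod volume) := by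
  have h1 := conv_int f φ
  have mp : MeasurePreserving (Prod.map (Neg.neg : ℝ → ℝ) (id : ℝ → ℝ))
      ((volume : Measure ℝ).prod (volume : Measure ℝ)) (volume.prod volume) :=
    (Measure.measurePreserving_neg volume).prod (MeasurePreserving.id volume)
  have := mp.integrable_comp_of_integrable h1
  refine this.congr (Eventually.of_forall fun p => ?_)
  simp

lemma symInt_prod_integrable {h : ℝ} (hh : 0 < h) (f φ : SchwartzMap ℝ ℂ) :
    Integrable (fun p : ℝ × ℝ => symInt h f p.2 p.1 * (starRingEnd ℂ) (φ p.2))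
      ((volume.restrict (Set.Ioi 0)).prod volume) := by
  obtain ⟨A, B, hA, hB, hb⟩ := symInt_bound hh f
  have i3 : Integrable ((Set.Ioc (0:ℝ) 1).indicator (fun _ => B)) :=
    (integrable_indicator_iff measurableSet_Ioc).2 (integrableOn_const (by simp))
  have i4 := (((conv_int f φ).add (conv_int' f φ)).const_mul A).add
    (i3.mul_prod φ.integrable.norm)
  have hr : (volume.restrict (Set.Ioi (0:ℝ))).prod (volume : Measure ℝ) =
      (volume.prod volume).restrict (Set.Ioi (0:ℝ) ×ˢ Set.univ) := by
    rw [← Measure.prod_restrict, Measure.restrict_univ]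
  rw [hr]
  have hφ := φ.continuous.measurable
  have hm := symInt_measurable h f
  refine i4.integrableOn.mono' ?_ ?_
  · exact (hm.mul (Complex.continuous_conj.measurable.comp
      (hφ.comp measurable_snd))).aestronglyMeasurable
  · filter_upwards [ae_restrict_mem (measurableSet_Ioi.prod MeasurableSet.univ)] with p hp
    have h1 := hb p.2 p.1 hp.1
    simp only [Pi.add_apply, norm_mul, RCLike.norm_conj]
    calc _ ≤ (A * (‖f (p.2 - p.1)‖ + ‖f (p.2 + p.1)‖) +
          (Set.Ioc (0:ℝ) 1).indicator (fun _ => B) p.1) * ‖φ p.2‖ := by gcongr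
      _ = _ := by ring

lemma trunc_eq {h : ℝ} (hh : 0 < h) (f : SchwartzMap ℝ ℂ) (x : ℝ) {ε : ℝ} (hε : 0 < ε) :
    truncTilbert h f x ε = (2 * h)⁻¹ • ∫ t in Set.Ioi ε, symInt h f x t := by
  have hpi := Real.pi_pos
  unfold truncTilbert
  congr 1
  set k : ℝ → ℂ := fun t => (coth (Real.pi * t / (2 * h)) : ℂ) with hk
  have hkm : Measurable k := by
    have := measurable_coth
    fun_prop
  have hkneg : ∀ t, k (-t) = - k t := by
    intro t
    simp only [hk]
    rw [show Real.pi * -t / (2 * h) = -(Real.pi * t / (2 * h)) by ring, coth_neg]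
    push_cast; rfl
  have hkb : ∀ t, ε < t → ‖k t‖ ≤ 1 + 2 * h / (Real.pi * ε) := by
    intro t ht
    have ht0 : 0 < t := hε.trans ht
    simp only [hk]
    rw [Complex.norm_real, Real.norm_of_nonneg (coth_nonneg (by positivity))]
    refine (coth_le (by positivity)).trans ?_
    rw [one_div_div]
    gcongr
  have hi : ∀ u : ℝ → ℂ, Integrable u → IntegrableOn (fun t => k t * u t) (Set.Ioi ε) := by
    intro u hu
    refine hu.integrableOn.bdd_mul hkm.aestronglyMeasurable ?_ (c := 1 + 2 * h / (Real.pi * ε))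
    filter_upwards [ae_restrict_mem measurableSet_Ioi] with t ht using hkb t ht
  have i1 : Integrable (fun t : ℝ => f (x - t)) := f.integrable.comp_sub_left x
  have i2 : Integrable (fun t : ℝ => f (x + t)) := f.integrable.comp_add_left x
  have hset : MeasurableSet {t : ℝ | ε < |t|} := measurableSet_lt measurable_const (by fun_prop)
  have hset' : MeasurableSet {y : ℝ | ε < |x - y|} :=
    measurableSet_lt measurable_const (by fun_prop)
  have s1 : ∫ y in {y : ℝ | ε < |x - y|}, k (x - y) * f y =
      ∫ t in {t : ℝ | ε < |t|}, k t * f (x - t) := by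
    rw [← integral_indicator hset, ← integral_indicator hset',
      ← integral_sub_left_eq_self
        ({t : ℝ | ε < |t|}.indicator fun t => k t * f (x - t)) volume x]
    congr 1
    ext y
    by_cases hy : ε < |x - y|
    · rw [Set.indicator_of_mem (by exact hy), Set.indicator_of_mem (by exact hy)]
      simp
    · rw [Set.indicator_of_notMem (by exact hy), Set.indicator_of_notMem (by exact hy)]
  have hun : {t : ℝ | ε < |t|} = Set.Iio (-ε) ∪ Set.Ioi ε := by
    ext t
    simp only [Set.mem_ofPred_eq, Set.mem_union, Set.mem_Iio, Set.mem_Ioi, lt_abs]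
    constructor
    · rintro (h | h)
      · right; exact h
      · left; linarith
    · rintro (h | h)
      · right; linarith
      · left; exact h
  have hdis : Disjoint (Set.Iio (-ε)) (Set.Ioi ε) := by
    rw [Set.disjoint_left]
    intro t h1 h2
    simp only [Set.mem_Iio, Set.mem_Ioi] at h1 h2
    linarith
  have hneg : IntegrableOn (fun t => k t * f (x - t)) (Set.Iio (-ε)) := by
    have h1 : IntegrableOn (fun t => -(k t * f (x + t))) (Set.Ioi (- -ε)) := by
      rw [neg_neg]; exact (hi _ i2).neg
    have h2 := h1.comp_neg_Iio
    have e : (fun t => k t * f (x - t)) = fun t => -(k (-t) * f (x + -t)) := by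
      ext t
      rw [hkneg, sub_eq_add_neg]; ring
    rw [e]
    exact h2
  change ∫ y in {y : ℝ | ε < |x - y|}, k (x - y) * f y = _
  rw [s1, hun, setIntegral_union hdis measurableSet_Ioi hneg (hi _ i1), ← integral_Iic_eq_integral_Iio,
    ← integral_comp_neg_Ioi ε (fun t => k t * f (x - t))]
  have e : ∀ t, k (-t) * f (x - -t) = - (k t * f (x + t)) := by
    intro t; rw [hkneg, sub_neg_eq_add]; ring
  simp_rw [e]
  rw [integral_neg, neg_add_eq_sub, ← integral_sub (hi _ i1) (hi _ i2)]
  congr 1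
  ext t
  simp only [symInt, hk]
  ring

lemma F_eq {h : ℝ} (hh : 0 < h) (f : SchwartzMap ℝ ℂ) (x : ℝ) (Fx : ℂ)
    (hpv : Tendsto (fun ε => truncTilbert h (⇑f) x ε) (nhdsWithin 0 (Set.Ioi 0)) (nhds Fx)) :
    Fx = (2 * h)⁻¹ • ∫ t in Set.Ioi 0, symInt h f x t := by
  refine tendsto_nhds_unique hpv ?_
  have hc : AECover (volume.restrict (Set.Ioi (0:ℝ))) (nhdsWithin (0:ℝ) (Set.Ioi 0))
      (fun ε : ℝ => Set.Ioi ε) := aecover_Ioi_of_Ioi (tendsto_id.mono_left nhdsWithin_le_nhds)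
  have h1 := (hc.integral_tendsto_of_countably_generated (symInt_integrable hh f x)).const_smul
    (2 * h)⁻¹
  refine h1.congr' ?_
  filter_upwards [self_mem_nhdsWithin] with ε hε
  have hε : 0 < ε := hε
  rw [trunc_eq hh f x hε, Measure.restrict_restrict measurableSet_Ioi,
    Set.inter_eq_left.2 (Set.Ioi_subset_Ioi hε.le)]

/-- The Tilbert transform `𝒯_h` is the Fourier multiplier operator with symbol
`−i coth(hξ)`: if `F = 𝒯_h f` (as a principal value), then for every Schwartz `φ`
whose Fourier transform vanishes near `ξ = 0`,
`∫ F conj(φ) dx = ∫ (−i coth(hξ)) f̂(ξ) conj(φ̂(ξ)) dξ`. -/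
theorem tilbert_multiplier (h : ℝ) (hh : 0 < h) (f : SchwartzMap ℝ ℂ) (F : ℝ → ℂ)
    (hFm : Measurable F) (hFb : ∃ C : ℝ, ∀ x, ‖F x‖ ≤ C)
    (hpv : ∀ x : ℝ, Tendsto (fun ε => truncTilbert h (⇑f) x ε)
      (nhdsWithin 0 (Set.Ioi 0)) (nhds (F x))) :
    ∀ φ : SchwartzMap ℝ ℂ, (∃ δ : ℝ, 0 < δ ∧ ∀ ξ : ℝ, |ξ| < δ → FT (⇑φ) ξ = 0) →
      (∫ x : ℝ, F x * (starRingEnd ℂ) (φ x)) =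
        ∫ ξ : ℝ, (-Complex.I * (coth (h * ξ) : ℂ)) * FT (⇑f) ξ *
          (starRingEnd ℂ) (FT (⇑φ) ξ) := by
  rintro φ ⟨δ, hδ0, hδ⟩
  have hF : ∀ x, F x = (2 * h)⁻¹ • ∫ t in Set.Ioi 0, symInt h f x t :=
    fun x => F_eq hh f x _ (hpv x)
  have hhC : (h : ℂ) ≠ 0 := by exact_mod_cast hh.ne'
  have hprod := symInt_prod_integrable hh f φ
  have hinner : ∀ t : ℝ, ∫ x : ℝ, symInt h f x t * (starRingEnd ℂ) (φ x) =
      (-2 * I) * ((coth (Real.pi * t / (2 * h)) : ℂ) *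
        ∫ ξ : ℝ, (Real.sin (t * ξ) : ℂ) * (FT f ξ * (starRingEnd ℂ) (FT φ ξ))) := by
    intro t
    rw [mul_left_comm, ← parseval_diff, ← integral_const_mul]
    simp only [symInt, mul_assoc]
  have hcint : IntegrableOn (fun t : ℝ => (coth (Real.pi * t / (2 * h)) : ℂ) *
      ∫ ξ : ℝ, (Real.sin (t * ξ) : ℂ) * (FT f ξ * (starRingEnd ℂ) (FT φ ξ))) (Set.Ioi 0) := by
    have h1 := hprod.integral_prod_left
    simp only [hinner] at h1
    refine (h1.const_mul (I / 2)).congr (Eventually.of_forall fun t => ?_)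
    simp only
    rw [← mul_assoc, show I / 2 * (-2 * I) = 1 by linear_combination -I_sq, one_mul]
  have key := multiplier_aux hh (fun ξ => FT f ξ * (starRingEnd ℂ) (FT φ ξ)) (g_integrable f φ)
    (g_integrable' f φ) hδ0 (fun ξ hξ => by simp [hδ ξ hξ]) hcint
  have e1 : ∀ x, F x * (starRingEnd ℂ) (φ x) =
      (((2 * h)⁻¹ : ℝ) : ℂ) * ∫ t in Set.Ioi 0, symInt h f x t * (starRingEnd ℂ) (φ x) := by
    intro x
    rw [hF, integral_mul_const, Complex.real_smul, mul_assoc]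
  simp_rw [e1]
  rw [integral_const_mul, ← integral_integral_swap hprod]
  simp_rw [hinner]
  rw [integral_const_mul, key]
  have e2 : (((2 * h)⁻¹ : ℝ) : ℂ) * (-2 * I * (h * ∫ ξ : ℝ, (coth (h * ξ) : ℂ) *
      (FT f ξ * (starRingEnd ℂ) (FT φ ξ)))) = (-I) * ∫ ξ : ℝ, (coth (h * ξ) : ℂ) *
      (FT f ξ * (starRingEnd ℂ) (FT φ ξ)) := by
    push_cast
    field_simp
  rw [e2, ← integral_const_mul]
  congr 1
  ext ξ
  ring
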